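/- arXiv:2407.09031 — 2 statements merged into one kernel-verified Lean document; each statement's English description precedes it below -/
import Mathlib

section
/- With ā = a * μ and b̄ = b * μ (convolution with the standard Gaussian), where b_i(z) = -2|z|^γ z_i, one has b̄(v) = -ℓ₁(v) v for all v ∈ ℝ³, where ℓ₁(v) is the eigenvalue of ā(v) associated with the eigenvector v. -/
open MeasureTheory Set

noncomputable section

/-- The integral of a directional derivative of a compactly supported `C¹` function vanishes. -/
lemma integral_fderiv_eq_zero_of_hasCompactSupport {E : Type*} [NormedAddCommGroup E]
    [NormedSpace ℝ E] [FiniteDimensional ℝ E] [MeasurableSpace E] [BorelSpace E]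
    (ν : Measure E) [ν.IsAddHaarMeasure] {g : E → ℝ} (hg : ContDiff ℝ 1 g)
    (hs : HasCompactSupport g) (u : E) : ∫ x, fderiv ℝ g x u ∂ν = 0 := by
  have hc : Continuous fun x => fderiv ℝ g x u :=
    (hg.continuous_fderiv one_ne_zero).clm_apply continuous_const
  have h := integral_mul_fderiv_eq_neg_fderiv_mul_of_integrable (μ := ν)
    (f := fun _ : E => (1 : ℝ)) (g := g) (v := u) (by simp)
    (by simpa using hc.integrable_of_hasCompactSupport (hs.fderiv_apply ℝ u))
    (by simpa using hg.continuous.integrable_of_hasCompactSupport hs)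
    (fun x _ => differentiableAt_const _) (fun x _ => hg.differentiable one_ne_zero x)
  simpa using h

/-- The tensor `|z|² δᵢⱼ - zᵢ zⱼ`. -/
def projTensor (z : EuclideanSpace ℝ (Fin 3)) (i j : Fin 3) : ℝ :=
  ‖z‖ ^ 2 * (if i = j then (1 : ℝ) else 0) - z i * z j

lemma abs_projTensor_le (z : EuclideanSpace ℝ (Fin 3)) (i j : Fin 3) :
    |projTensor z i j| ≤ 2 * ‖z‖ ^ 2 := by
  have h1 : |z i * z j| ≤ ‖z‖ ^ 2 := by
    rw [abs_mul, sq]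
    exact mul_le_mul (PiLp.norm_apply_le z i) (PiLp.norm_apply_le z j) (abs_nonneg _)
      (norm_nonneg _)
  have h2 := abs_le.1 h1
  have h3 := sq_nonneg ‖z‖
  unfold projTensor
  split_ifs <;> rw [abs_le] <;> constructor <;> linarith

lemma contDiff_projTensor (i j : Fin 3) : ContDiff ℝ 1 fun z => projTensor z i j := by
  unfold projTensor
  have h : ∀ k : Fin 3, ContDiff ℝ 1 fun z : EuclideanSpace ℝ (Fin 3) => z k := fun k =>
    (EuclideanSpace.proj (𝕜 := ℝ) k : EuclideanSpace ℝ (Fin 3) →L[ℝ] ℝ).contDiff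
  exact ((contDiff_norm_sq ℝ).mul contDiff_const).sub ((h i).mul (h j))

/-- The row `i` of the field `φ(|z|²) (|z|² I - z ⊗ z) e^{-|v - z|² / 2}`. -/
def gaussField (φ : ℝ → ℝ) (v : EuclideanSpace ℝ (Fin 3)) (i j : Fin 3)
    (z : EuclideanSpace ℝ (Fin 3)) : ℝ :=
  φ (‖z‖ ^ 2) * projTensor z i j * Real.exp (-‖v - z‖ ^ 2 / 2)

lemma contDiff_gaussField {φ : ℝ → ℝ} (hφ : ContDiff ℝ 1 φ) (v : EuclideanSpace ℝ (Fin 3))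
    (i j : Fin 3) : ContDiff ℝ 1 (gaussField φ v i j) := by
  unfold gaussField
  refine ((hφ.comp (contDiff_norm_sq ℝ)).mul (contDiff_projTensor i j)).mul ?_
  exact Real.contDiff_exp.comp
    ((((contDiff_norm_sq ℝ).comp (contDiff_const.sub contDiff_id)).neg).div_const 2)

lemma hasCompactSupport_comp_norm_sq {φ : ℝ → ℝ} (hs : HasCompactSupport φ) :
    HasCompactSupport fun z : EuclideanSpace ℝ (Fin 3) => φ (‖z‖ ^ 2) := by
  obtain ⟨R, hR⟩ := hs.isCompact.isBounded.bddAbove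
  refine HasCompactSupport.intro (isCompact_closedBall 0 (Real.sqrt (max R 0))) fun z hz => ?_
  by_contra h
  refine hz ?_
  have := hR (subset_tsupport φ h)
  rw [mem_closedBall_zero_iff]
  exact Real.le_sqrt_of_sq_le (this.trans (le_max_left _ _))

lemma fderiv_gaussField {φ : ℝ → ℝ} (hφ : ContDiff ℝ 1 φ) (v z : EuclideanSpace ℝ (Fin 3))
    (i j : Fin 3) :
    fderiv ℝ (gaussField φ v i j) z (EuclideanSpace.single j 1) =
      (deriv φ (‖z‖ ^ 2) * (2 * z j) * projTensor z i j
        + φ (‖z‖ ^ 2) * (2 * z j * (if i = j then (1 : ℝ) else 0)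
          - ((if i = j then (1 : ℝ) else 0) * z j + z i))
        + φ (‖z‖ ^ 2) * projTensor z i j * (v j - z j)) * Real.exp (-‖v - z‖ ^ 2 / 2) := by
  have hd := (contDiff_gaussField hφ v i j).differentiable one_ne_zero z
  rw [← hd.lineDeriv_eq_fderiv]
  refine HasLineDerivAt.lineDeriv ?_
  set e : EuclideanSpace ℝ (Fin 3) := EuclideanSpace.single j 1
  have hid : HasDerivAt (fun t : ℝ => z + t • e) e 0 := by
    simpa using ((hasDerivAt_id (0 : ℝ)).smul_const e).const_add z
  have hcoord : ∀ k, HasDerivAt (fun t : ℝ => (z + t • e) k) (e k) 0 := fun k =>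
    (EuclideanSpace.proj (𝕜 := ℝ) k : EuclideanSpace ℝ (Fin 3) →L[ℝ] ℝ).hasFDerivAt.comp_hasDerivAt 0 hid
  have hN : HasDerivAt (fun t : ℝ => ‖z + t • e‖ ^ 2) (2 * z j) 0 := by
    simpa [e, EuclideanSpace.inner_single_right] using hid.norm_sq
  have hM : HasDerivAt (fun t : ℝ => ‖v - (z + t • e)‖ ^ 2) (2 * (z j - v j)) 0 := by
    simpa [e, EuclideanSpace.inner_single_right] using (hid.const_sub v).norm_sq
  have hφ' : HasDerivAt (fun t : ℝ => φ (‖z + t • e‖ ^ 2)) (deriv φ (‖z‖ ^ 2) * (2 * z j)) 0 := by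
    have := (hφ.differentiable one_ne_zero (‖z + (0 : ℝ) • e‖ ^ 2)).hasDerivAt.comp 0 hN
    simpa [Function.comp_def] using this
  have hP := (hN.mul_const (if i = j then (1 : ℝ) else 0)).sub ((hcoord i).mul (hcoord j))
  have hE := (hM.neg.div_const 2).exp
  have hei : e i = if i = j then (1 : ℝ) else 0 := by simp [e]
  have hej : e j = 1 := by simp [e]
  refine ((hφ'.mul hP).mul hE).congr_deriv ?_
  simp [hei, hej, projTensor]
  ring

lemma sum_fderiv_gaussField {φ : ℝ → ℝ} (hφ : ContDiff ℝ 1 φ) (v z : EuclideanSpace ℝ (Fin 3))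
    (i : Fin 3) :
    ∑ j, fderiv ℝ (gaussField φ v i j) z (EuclideanSpace.single j 1) =
      φ (‖z‖ ^ 2) * ((-2 * z i + ∑ j, projTensor z i j * v j) *
        Real.exp (-‖v - z‖ ^ 2 / 2)) := by
  simp_rw [fderiv_gaussField hφ, ← Finset.sum_mul]
  rw [← mul_assoc]
  congr 1
  have hz : ‖z‖ ^ 2 = z 0 ^ 2 + z 1 ^ 2 + z 2 ^ 2 := by
    rw [EuclideanSpace.real_norm_sq_eq, Fin.sum_univ_three]
  generalize hD : deriv φ (‖z‖ ^ 2) = D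
  generalize hF : φ (‖z‖ ^ 2) = F
  simp only [Fin.sum_univ_three, projTensor, hz]
  fin_cases i <;> simp <;> ring

/-- The divergence structure of the radial tensor `φ(|z|²) (|z|² I - z ⊗ z)`. -/
lemma integral_radial_mul_eq_zero {φ : ℝ → ℝ} (hφ : ContDiff ℝ 1 φ) (hs : HasCompactSupport φ)
    (v : EuclideanSpace ℝ (Fin 3)) (i : Fin 3) :
    ∫ z : EuclideanSpace ℝ (Fin 3), φ (‖z‖ ^ 2) * ((-2 * z i + ∑ j, projTensor z i j * v j) *
        Real.exp (-‖v - z‖ ^ 2 / 2)) = 0 := by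
  simp_rw [← sum_fderiv_gaussField hφ]
  have hsupp : ∀ j, HasCompactSupport (gaussField φ v i j) := fun j =>
    ((hasCompactSupport_comp_norm_sq hs).mul_right).mul_right
  have hc := fun j => contDiff_gaussField hφ v i j
  rw [integral_finsetSum]
  · exact Finset.sum_eq_zero fun j _ =>
      integral_fderiv_eq_zero_of_hasCompactSupport _ (hc j) (hsupp j) _
  · intro j _
    exact (((hc j).continuous_fderiv one_ne_zero).clm_apply
      continuous_const).integrable_of_hasCompactSupport ((hsupp j).fderiv_apply ℝ _)

lemma integrable_norm_rpow_mul_gaussian {p : ℝ} (hp : -3 < p) (v : EuclideanSpace ℝ (Fin 3)) :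
    Integrable fun z : EuclideanSpace ℝ (Fin 3) => ‖z‖ ^ p * Real.exp (-‖v - z‖ ^ 2 / 2) := by
  have h : Integrable fun z : EuclideanSpace ℝ (Fin 3) =>
      ‖z‖ ^ p * Real.exp (-(1 / 4) * ‖z‖ ^ 2) := by
    rw [integrable_fun_norm_addHaar (μ := (volume : Measure (EuclideanSpace ℝ (Fin 3))))
      (f := fun r => r ^ p * Real.exp (-(1 / 4) * r ^ 2))]
    refine (integrableOn_rpow_mul_exp_neg_mul_sq (b := 1 / 4) (by norm_num)
      (s := p + 2) (by linarith)).congr_fun (fun r hr => ?_) measurableSet_Ioi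
    have hr : 0 < r := hr
    simp [Real.rpow_add hr]
    ring
  refine (h.const_mul (Real.exp (‖v‖ ^ 2 / 2))).mono' (by fun_prop) (ae_of_all _ fun z => ?_)
  rw [Real.norm_of_nonneg (by positivity), mul_left_comm, ← Real.exp_add]
  gcongr
  have h1 : ‖z‖ ≤ ‖v‖ + ‖v - z‖ := by
    simpa using norm_sub_le v (v - z)
  nlinarith [sq_nonneg (‖v‖ - ‖v - z‖), norm_nonneg z]

/-- A smooth cutoff to the interval `(1 / n, n)`. -/
def cutoff (n : ℕ) (s : ℝ) : ℝ :=
  Real.smoothTransition (n * s - 1) * Real.smoothTransition (n - s)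

lemma cutoff_nonneg (n : ℕ) (s : ℝ) : 0 ≤ cutoff n s :=
  mul_nonneg (Real.smoothTransition.nonneg _) (Real.smoothTransition.nonneg _)

lemma cutoff_le_one (n : ℕ) (s : ℝ) : cutoff n s ≤ 1 :=
  mul_le_one₀ (Real.smoothTransition.le_one _) (Real.smoothTransition.nonneg _)
    (Real.smoothTransition.le_one _)

lemma contDiff_cutoff (n : ℕ) : ContDiff ℝ 1 (cutoff n) := by
  have h : ContDiff ℝ 1 Real.smoothTransition := Real.smoothTransition.contDiff (n := 1)
  exact (h.comp ((contDiff_const.mul contDiff_id).sub contDiff_const)).mul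
    (h.comp (contDiff_const.sub contDiff_id))

lemma cutoff_eq_zero_of_mul_le {n : ℕ} {s : ℝ} (h : n * s ≤ 1) : cutoff n s = 0 := by
  rw [cutoff, Real.smoothTransition.zero_of_nonpos (by linarith), zero_mul]

lemma cutoff_eq_zero_of_le {n : ℕ} {s : ℝ} (h : n ≤ s) : cutoff n s = 0 := by
  rw [cutoff, Real.smoothTransition.zero_of_nonpos (x := n - s) (by linarith), mul_zero]

lemma hasCompactSupport_cutoff (n : ℕ) : HasCompactSupport (cutoff n) := by
  refine HasCompactSupport.intro (isCompact_Icc (a := (0 : ℝ)) (b := n)) fun s hs => ?_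
  by_cases h0 : 0 ≤ s
  · exact cutoff_eq_zero_of_le (le_of_lt (by_contra fun h => hs ⟨h0, not_lt.1 h⟩))
  · refine cutoff_eq_zero_of_mul_le ?_
    have : (n : ℝ) * s ≤ 0 := mul_nonpos_of_nonneg_of_nonpos n.cast_nonneg (not_le.1 h0).le
    linarith

lemma eventually_cutoff_eq_one {s : ℝ} (hs : 0 < s) : ∀ᶠ n in Filter.atTop, cutoff n s = 1 := by
  have h := tendsto_natCast_atTop_atTop (R := ℝ)
  filter_upwards [h.eventually_ge_atTop (2 / s), h.eventually_ge_atTop (s + 1)] with n h1 h2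
  rw [div_le_iff₀ hs] at h1
  rw [cutoff, Real.smoothTransition.one_of_one_le (by linarith),
    Real.smoothTransition.one_of_one_le (by linarith), one_mul]

lemma contDiff_cutoff_mul_rpow (n : ℕ) (q : ℝ) :
    ContDiff ℝ 1 fun s : ℝ => cutoff n s * s ^ q := by
  rw [contDiff_iff_contDiffAt]
  intro s
  by_cases hs : s = 0
  · refine (contDiffAt_const (c := (0 : ℝ))).congr_of_eventuallyEq ?_
    have : Filter.Tendsto (fun t : ℝ => n * t) (nhds s) (nhds (n * s)) :=
      (continuous_const.mul continuous_id).tendsto s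
    rw [hs, mul_zero] at this
    rw [hs]
    filter_upwards [this.eventually_lt_const one_pos] with t ht
    rw [cutoff_eq_zero_of_mul_le ht.le, zero_mul]
  · exact (contDiff_cutoff n).contDiffAt.mul (Real.contDiffAt_rpow_const_of_ne hs)

/-- If `h` is orthogonal to all smooth radial functions with compact support, it is orthogonal to
every power of the norm. -/
lemma integral_norm_rpow_mul_eq_zero {γ : ℝ} {h : EuclideanSpace ℝ (Fin 3) → ℝ}
    (hrad : ∀ φ : ℝ → ℝ, ContDiff ℝ 1 φ → HasCompactSupport φ → ∫ z, φ (‖z‖ ^ 2) * h z = 0)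
    (hint : Integrable fun z => ‖z‖ ^ γ * h z) :
    ∫ z, ‖z‖ ^ γ * h z = 0 := by
  have hpow : ∀ z : EuclideanSpace ℝ (Fin 3), (‖z‖ ^ 2) ^ (γ / 2) = ‖z‖ ^ γ := fun z => by
    rw [← Real.rpow_natCast, ← Real.rpow_mul (norm_nonneg z)]
    congr 1
    push_cast
    ring
  have hzero : ∀ n : ℕ, ∫ z, cutoff n (‖z‖ ^ 2) * (‖z‖ ^ γ * h z) = 0 := fun n => by
    have := hrad _ (contDiff_cutoff_mul_rpow n (γ / 2)) (hasCompactSupport_cutoff n).mul_right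
    simpa only [hpow, mul_assoc] using this
  have hmeas : ∀ n : ℕ, AEStronglyMeasurable
      (fun z : EuclideanSpace ℝ (Fin 3) => cutoff n (‖z‖ ^ 2) * (‖z‖ ^ γ * h z)) volume := fun n =>
    Continuous.aestronglyMeasurable (f := fun z : EuclideanSpace ℝ (Fin 3) => cutoff n (‖z‖ ^ 2))
      ((contDiff_cutoff n).continuous.comp (continuous_norm.pow 2)) |>.mul
        hint.aestronglyMeasurable
  have hbound : ∀ (n : ℕ) (z : EuclideanSpace ℝ (Fin 3)),
      ‖cutoff n (‖z‖ ^ 2) * (‖z‖ ^ γ * h z)‖ ≤ ‖‖z‖ ^ γ * h z‖ := fun n z => by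
    rw [norm_mul, Real.norm_of_nonneg (cutoff_nonneg _ _)]
    exact mul_le_of_le_one_left (norm_nonneg _) (cutoff_le_one _ _)
  have hpt : ∀ᵐ z : EuclideanSpace ℝ (Fin 3), Filter.Tendsto
      (fun n : ℕ => cutoff n (‖z‖ ^ 2) * (‖z‖ ^ γ * h z)) Filter.atTop
      (nhds (‖z‖ ^ γ * h z)) := by
    filter_upwards [Measure.ae_ne volume (0 : EuclideanSpace ℝ (Fin 3))] with z hz
    refine tendsto_const_nhds.congr' ?_
    have hz' : 0 < ‖z‖ := norm_pos_iff.2 hz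
    filter_upwards [eventually_cutoff_eq_one (pow_pos hz' 2)] with n hn
    rw [hn, one_mul]
  have hlim := tendsto_integral_of_dominated_convergence (fun z => ‖‖z‖ ^ γ * h z‖)
    hmeas hint.norm (fun n => ae_of_all _ (hbound n)) hpt
  simp only [hzero] at hlim
  exact tendsto_nhds_unique hlim tendsto_const_nhds

/-- With `ā = a * μ` and `b̄ = b * μ` (convolutions with the standard Gaussian),
where `b_i(z) = -2|z|^γ z_i`, one has `b̄(v) = -ℓ₁(v) v` for all `v`, where `ℓ₁(v)` is the
eigenvalue of `ā(v)` associated with the eigenvector `v`. -/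
theorem bbar_eq_neg_ell1_v
    (γ : ℝ) (hγ : γ ∈ Set.Icc (-3 : ℝ) 1)
    (a : EuclideanSpace ℝ (Fin 3) → Fin 3 → Fin 3 → ℝ)
    (ha : ∀ z : EuclideanSpace ℝ (Fin 3), ∀ i j : Fin 3,
      a z i j = ‖z‖ ^ (γ + 2) * ((if i = j then (1 : ℝ) else 0) - z i * z j / ‖z‖ ^ 2))
    (b : EuclideanSpace ℝ (Fin 3) → Fin 3 → ℝ)
    (hb : ∀ z i, b z i = -2 * ‖z‖ ^ γ * z i)
    (μ : EuclideanSpace ℝ (Fin 3) → ℝ)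
    (hμ : ∀ v, μ v = (2 * Real.pi) ^ (-(3 : ℝ) / 2) * Real.exp (-‖v‖ ^ 2 / 2))
    (abar : EuclideanSpace ℝ (Fin 3) → Fin 3 → Fin 3 → ℝ)
    (habar : ∀ v i j, abar v i j = ∫ w : EuclideanSpace ℝ (Fin 3), a (v - w) i j * μ w)
    (bbar : EuclideanSpace ℝ (Fin 3) → Fin 3 → ℝ)
    (hbbar : ∀ v i, bbar v i = ∫ w : EuclideanSpace ℝ (Fin 3), b (v - w) i * μ w)
    (ℓ₁ : EuclideanSpace ℝ (Fin 3) → ℝ)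
    (hℓ₁ : ∀ v i, (∑ j, abar v i j * v j) = ℓ₁ v * v i) :
    ∀ v : EuclideanSpace ℝ (Fin 3), ∀ i : Fin 3, bbar v i = -(ℓ₁ v) * v i := by
  intro v i
  set c : ℝ := (2 * Real.pi) ^ (-(3 : ℝ) / 2)
  have hb_int : Integrable fun z => b z i * μ (v - z) := by
    refine ((integrable_norm_rpow_mul_gaussian (p := γ + 1) (by linarith [hγ.1]) v).const_mul
      (2 * |c|)).mono' (by simp only [hb, hμ]; fun_prop) ?_
    filter_upwards [Measure.ae_ne volume (0 : EuclideanSpace ℝ (Fin 3))] with z hz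
    have hz' : 0 < ‖z‖ := norm_pos_iff.2 hz
    rw [hb, hμ, Real.rpow_add hz', Real.rpow_one]
    simp only [norm_mul, norm_neg, Real.norm_ofNat, Real.norm_eq_abs, Real.abs_exp,
      abs_of_nonneg (Real.rpow_nonneg hz'.le γ)]
    calc 2 * ‖z‖ ^ γ * |z i| * (|c| * Real.exp (-‖v - z‖ ^ 2 / 2))
        ≤ 2 * ‖z‖ ^ γ * ‖z‖ * (|c| * Real.exp (-‖v - z‖ ^ 2 / 2)) := by
          gcongr
          exact PiLp.norm_apply_le z i
      _ = _ := by ring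
  have ha_eq : ∀ z : EuclideanSpace ℝ (Fin 3), z ≠ 0 → ∀ j,
      a z i j = ‖z‖ ^ γ * projTensor z i j := fun z hz j => by
    have hz' : 0 < ‖z‖ := norm_pos_iff.2 hz
    rw [ha, Real.rpow_add hz', Real.rpow_two, projTensor]
    field_simp
  have ha_int : ∀ j, Integrable fun z => a z i j * μ (v - z) := fun j => by
    refine ((integrable_norm_rpow_mul_gaussian (p := γ + 2) (by linarith [hγ.1]) v).const_mul
      (2 * |c|)).mono' (by simp only [ha, hμ]; fun_prop) ?_
    filter_upwards [Measure.ae_ne volume (0 : EuclideanSpace ℝ (Fin 3))] with z hz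
    have hz' : 0 < ‖z‖ := norm_pos_iff.2 hz
    rw [ha_eq z hz, hμ, Real.rpow_add hz', Real.rpow_two]
    simp only [norm_mul, Real.norm_eq_abs, Real.abs_exp,
      abs_of_nonneg (Real.rpow_nonneg hz'.le γ)]
    calc ‖z‖ ^ γ * |projTensor z i j| * (|c| * Real.exp (-‖v - z‖ ^ 2 / 2))
        ≤ ‖z‖ ^ γ * (2 * ‖z‖ ^ 2) * (|c| * Real.exp (-‖v - z‖ ^ 2 / 2)) := by
          gcongr
          exact abs_projTensor_le z i j
      _ = _ := by ring
  have hb' : bbar v i = ∫ z, b z i * μ (v - z) := by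
    rw [hbbar, ← integral_sub_left_eq_self _ volume v]
    simp
  have ha' : ∀ j, abar v i j = ∫ z, a z i j * μ (v - z) := fun j => by
    rw [habar, ← integral_sub_left_eq_self _ volume v]
    simp
  have hsum_int : Integrable fun z => ∑ j, a z i j * μ (v - z) * v j :=
    integrable_finsetSum _ fun j _ => (ha_int j).mul_const (v j)
  have hsum : bbar v i + ∑ j, abar v i j * v j =
      ∫ z, (b z i * μ (v - z) + ∑ j, a z i j * μ (v - z) * v j) := by
    rw [integral_add hb_int hsum_int, integral_finsetSum _ fun j _ => (ha_int j).mul_const (v j)]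
    simp only [hb', ha', integral_mul_const]
  have hcongr : (fun z => b z i * μ (v - z) + ∑ j, a z i j * μ (v - z) * v j) =ᵐ[volume]
      fun z => c * (‖z‖ ^ γ *
        ((-2 * z i + ∑ j, projTensor z i j * v j) * Real.exp (-‖v - z‖ ^ 2 / 2))) := by
    filter_upwards [Measure.ae_ne volume (0 : EuclideanSpace ℝ (Fin 3))] with z hz
    simp only [ha_eq z hz, hb, hμ, Fin.sum_univ_three]
    ring
  have hc : c ≠ 0 := (Real.rpow_pos_of_pos (by positivity) _).ne'
  have hint := (integrable_const_mul_iff (IsUnit.mk0 c hc) _).1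
    ((hb_int.add hsum_int).congr hcongr)
  have hzero : bbar v i + ∑ j, abar v i j * v j = 0 := by
    rw [hsum, integral_congr_ae hcongr, integral_const_mul,
      integral_norm_rpow_mul_eq_zero
        (fun _ hφ hs => integral_radial_mul_eq_zero hφ hs v i) hint, mul_zero]
  rw [hℓ₁] at hzero
  linarith
end
end

section
/- Let γ ∈ [-3,1], p ∈ [1,∞], k > 0, s ∈ (0,2), and ω(v) = exp(κ⟨v⟩^s) with κ > 0, k = κs. For the operator B₀ f = ā_{ij}∂²_{v_iv_j} f - c̄ f (Gaussian-convolved Landau coefficients), the weight exponent function ϖ^{B₀}_{ω,p}(v) = 2(1-1/p) ā_{ij}(∂_iω/ω)(∂_jω/ω) + (2/p - 1) ā_{ij} ∂²_{ij}ω/ω + (2/p) b̄_i ∂_iω/ω + (1/p - 1) c̄ satisfies limsup_{|v|→∞} ⟨v⟩^{-γ-s} ϖ^{B₀}_{ω,p}(v) ≤ -2k < 0. -/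
open MeasureTheory Set ENNReal

noncomputable section

/-- Partial derivative in the `i`-th velocity direction. -/
def pd (h : EuclideanSpace ℝ (Fin 3) → ℝ) (i : Fin 3) :
    EuclideanSpace ℝ (Fin 3) → ℝ :=
  fun v => fderiv ℝ h v (EuclideanSpace.single i 1)

open Filter Topology Bornology

local notation "𝔼" => EuclideanSpace ℝ (Fin 3)

lemma hasFDerivAt_one_add_norm_sq_rpow (a : ℝ) (v : 𝔼) :
    HasFDerivAt (fun v : 𝔼 => (1 + ‖v‖ ^ 2) ^ a)
      ((a * (1 + ‖v‖ ^ 2) ^ (a - 1)) • (2 • innerSL ℝ v)) v := by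
  have h1 : HasFDerivAt (fun v : 𝔼 => 1 + ‖v‖ ^ 2)
      (2 • innerSL ℝ v) v := ((hasStrictFDerivAt_norm_sq v).hasFDerivAt).const_add 1
  exact h1.rpow_const (Or.inl (by positivity))

lemma pd_stretchedExp (κ s : ℝ) (i : Fin 3) (v : 𝔼) :
    pd (fun v => Real.exp (κ * (1 + ‖v‖ ^ 2) ^ (s / 2))) i v =
      Real.exp (κ * (1 + ‖v‖ ^ 2) ^ (s / 2)) *
        (κ * s * (1 + ‖v‖ ^ 2) ^ (s / 2 - 1) * v i) := by
  have h := ((hasFDerivAt_one_add_norm_sq_rpow (s / 2) v).const_mul κ).exp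
  simp only [pd, h.fderiv]
  simp [EuclideanSpace.inner_single_right]
  ring

lemma pd_pd_stretchedExp (κ s : ℝ) (i j : Fin 3) (v : 𝔼) :
    pd (pd (fun v => Real.exp (κ * (1 + ‖v‖ ^ 2) ^ (s / 2))) j) i v =
      Real.exp (κ * (1 + ‖v‖ ^ 2) ^ (s / 2)) *
        (((κ * s) ^ 2 * ((1 + ‖v‖ ^ 2) ^ (s / 2 - 1)) ^ 2
          + κ * s * (s - 2) * (1 + ‖v‖ ^ 2) ^ (s / 2 - 2)) * (v i * v j)
          + κ * s * (1 + ‖v‖ ^ 2) ^ (s / 2 - 1) * (if i = j then 1 else 0)) := by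
  have e : pd (fun v => Real.exp (κ * (1 + ‖v‖ ^ 2) ^ (s / 2))) j = fun v =>
      Real.exp (κ * (1 + ‖v‖ ^ 2) ^ (s / 2)) *
        (κ * s * (1 + ‖v‖ ^ 2) ^ (s / 2 - 1) * v j) := funext (pd_stretchedExp κ s j)
  have h1 := ((hasFDerivAt_one_add_norm_sq_rpow (s / 2) v).const_mul κ).exp
  have h2 := (hasFDerivAt_one_add_norm_sq_rpow (s / 2 - 1) v).const_mul (κ * s)
  have h3 : HasFDerivAt (fun v : 𝔼 => v j)
    (EuclideanSpace.proj j : 𝔼 →L[ℝ] ℝ) v :=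
    (EuclideanSpace.proj j : 𝔼 →L[ℝ] ℝ).hasFDerivAt
  have h := h1.mul (h2.mul h3)
  rw [e, pd]
  erw [h.fderiv]
  have : s / 2 - 1 - 1 = s / 2 - 2 := by ring
  simp [EuclideanSpace.inner_single_right, this, PiLp.single_apply, eq_comm (a := j)]
  split_ifs <;> ring

lemma integrable_indicator_ball_norm_rpow {α : ℝ} (hα : -3 < α) :
    Integrable (fun z : 𝔼 => (Set.Iio (1 : ℝ)).indicator (fun r => r ^ α) ‖z‖) := by
  rw [integrable_fun_norm_addHaar volume
    (f := fun r : ℝ => (Set.Iio (1 : ℝ)).indicator (fun r => r ^ α) r)]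
  have h : IntegrableOn (fun r : ℝ => r ^ (α + 2)) (Ioo 0 1) :=
    (intervalIntegral.integrableOn_Ioo_rpow_iff one_pos).2 (by linarith)
  have h' := (integrable_indicator_iff measurableSet_Ioo).2 h
  rw [← integrable_indicator_iff measurableSet_Ioi]
  refine h'.congr (Eventually.of_forall fun r => ?_)
  by_cases h0 : 0 < r
  · by_cases h1 : r < 1
    · simp only [Set.indicator, mem_Ioo, mem_Ioi, mem_Iio, h0, h1, and_self, if_true,
        finrank_euclideanSpace, Fintype.card_fin, smul_eq_mul]
      rw [Real.rpow_add h0, mul_comm]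
      norm_num
    · simp [Set.indicator, h0, h1]
  · simp [Set.indicator, h0]

lemma bracket_le_one_add_norm (v : 𝔼) : √(1 + ‖v‖ ^ 2) ≤ 1 + ‖v‖ := by
  rw [Real.sqrt_le_left (by positivity)]
  nlinarith [norm_nonneg v]

lemma norm_le_bracket (v : 𝔼) : ‖v‖ ≤ √(1 + ‖v‖ ^ 2) :=
  Real.le_sqrt_of_sq_le (by linarith)

lemma one_le_bracket (v : 𝔼) : 1 ≤ √(1 + ‖v‖ ^ 2) :=
  Real.one_le_sqrt.2 (by nlinarith [norm_nonneg v])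

lemma tendsto_bracket_cobounded :
    Tendsto (fun v : 𝔼 => √(1 + ‖v‖ ^ 2)) (cobounded 𝔼) atTop :=
  tendsto_atTop_mono norm_le_bracket tendsto_norm_cobounded_atTop

lemma rpow_le_pow_of_inv_le {r M α : ℝ} {n : ℕ} (hM : 1 ≤ M) (hr : 0 < r) (h1 : r ≤ M)
    (h2 : r⁻¹ ≤ M) (hn : |α| ≤ n) : r ^ α ≤ M ^ n := by
  have key : r ^ α ≤ M ^ |α| := by
    rcases le_total 0 α with h | h
    · rw [abs_of_nonneg h]
      exact Real.rpow_le_rpow hr.le h1 h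
    · rw [abs_of_nonpos h, show α = -(-α) by ring, Real.rpow_neg hr.le, ← Real.inv_rpow hr.le,
        neg_neg]
      exact Real.rpow_le_rpow (by positivity) h2 (by linarith)
  calc r ^ α ≤ M ^ |α| := key
    _ ≤ M ^ (n : ℝ) := Real.rpow_le_rpow_of_exponent_le hM hn
    _ = M ^ n := Real.rpow_natCast M n

/-- Peetre-type inequality away from the singularity. -/
lemma norm_sub_div_bracket_rpow_le {α : ℝ} {n : ℕ} (hn : |α| ≤ n) {v w : 𝔼}
    (h : 1 ≤ ‖v - w‖) :
    (‖v - w‖ / √(1 + ‖v‖ ^ 2)) ^ α ≤ (2 * (1 + ‖w‖)) ^ n := by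
  have h1 := one_le_bracket v
  have h2 := norm_le_bracket v
  have h3 := bracket_le_one_add_norm v
  have hw := norm_nonneg w
  have h4 : ‖v - w‖ ≤ ‖v‖ + ‖w‖ := norm_sub_le v w
  have h5 : ‖v‖ ≤ ‖v - w‖ + ‖w‖ := by
    simpa using norm_add_le (v - w) w
  refine rpow_le_pow_of_inv_le (by linarith) (by positivity) ?_ ?_ hn
  · rw [div_le_iff₀ (by positivity)]
    nlinarith
  · rw [inv_div, div_le_iff₀ (by positivity)]
    nlinarith

lemma tendsto_norm_sub_div_bracket (w : 𝔼) :
    Tendsto (fun v : 𝔼 => ‖v - w‖ / √(1 + ‖v‖ ^ 2)) (cobounded 𝔼) (𝓝 1) := by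
  rw [tendsto_iff_norm_sub_tendsto_zero]
  have hlim : Tendsto (fun v : 𝔼 => (1 + ‖w‖) / √(1 + ‖v‖ ^ 2)) (cobounded 𝔼) (𝓝 0) :=
    tendsto_const_nhds.div_atTop tendsto_bracket_cobounded
  refine squeeze_zero (fun _ => norm_nonneg _) (fun v => ?_) hlim
  have h1 := one_le_bracket v
  have h2 := norm_le_bracket v
  have h3 := bracket_le_one_add_norm v
  have h4 : ‖v - w‖ ≤ ‖v‖ + ‖w‖ := norm_sub_le v w
  have h5 : ‖v‖ ≤ ‖v - w‖ + ‖w‖ := by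
    simpa using norm_add_le (v - w) w
  rw [div_sub_one (by positivity), norm_div, Real.norm_of_nonneg (by positivity : 0 ≤ √(1 + ‖v‖ ^ 2))]
  gcongr
  rw [Real.norm_eq_abs, abs_le]
  constructor <;> linarith

/-- A continuous function decaying faster than every polynomial. -/
def RapidDecay (h : 𝔼 → ℝ) : Prop :=
  Continuous h ∧ ∀ n : ℕ, ∃ C, ∀ w, (1 + ‖w‖) ^ n * |h w| ≤ C

lemma RapidDecay.integrable_pow_mul {h : 𝔼 → ℝ} (hh : RapidDecay h) (n : ℕ) :
    Integrable (fun w => (2 * (1 + ‖w‖)) ^ n * |h w|) := by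
  obtain ⟨C, hC⟩ := hh.2 (n + 4)
  have hi : Integrable (fun w : 𝔼 => (1 + ‖w‖) ^ (-(4 : ℝ))) :=
    integrable_one_add_norm (by simp; norm_num)
  have hc := hh.1
  refine (hi.const_mul (2 ^ n * C)).mono' (by fun_prop)
    (Eventually.of_forall fun w => ?_)
  have hp : 0 < 1 + ‖w‖ := by positivity
  rw [Real.norm_of_nonneg (by positivity), mul_pow, mul_assoc, mul_assoc]
  refine mul_le_mul_of_nonneg_left ?_ (by positivity)
  rw [Real.rpow_neg hp.le, ← div_eq_mul_inv, le_div_iff₀ (by positivity)]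
  calc _ = (1 + ‖w‖) ^ (n + 4) * |h w| := by
        rw [pow_add]; norm_cast; ring
    _ ≤ C := hC w

/-- The kernel `|z|^α` restricted to `|z| < 1`. -/
def nearKernel (α : ℝ) (z : 𝔼) : ℝ := (Set.Iio (1 : ℝ)).indicator (fun r => r ^ α) ‖z‖

/-- The kernel `|z|^α` restricted to `|z| ≥ 1`. -/
def farKernel (α : ℝ) (z : 𝔼) : ℝ := (Set.Ici (1 : ℝ)).indicator (fun r => r ^ α) ‖z‖

lemma nearKernel_add_farKernel (α : ℝ) (z : 𝔼) :
    nearKernel α z + farKernel α z = ‖z‖ ^ α := by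
  by_cases h : ‖z‖ < 1
  · simp [nearKernel, farKernel, h]
  · simp [nearKernel, farKernel, h, not_lt.1 h]

lemma measurable_nearKernel (α : ℝ) : Measurable (nearKernel α) :=
  ((by fun_prop : Measurable fun r : ℝ => r ^ α).indicator measurableSet_Iio).comp measurable_norm

lemma measurable_farKernel (α : ℝ) : Measurable (farKernel α) :=
  ((by fun_prop : Measurable fun r : ℝ => r ^ α).indicator measurableSet_Ici).comp measurable_norm

lemma nearKernel_nonneg (α : ℝ) (z : 𝔼) : 0 ≤ nearKernel α z :=
  Set.indicator_apply_nonneg fun _ => Real.rpow_nonneg (norm_nonneg z) α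

lemma farKernel_nonneg (α : ℝ) (z : 𝔼) : 0 ≤ farKernel α z :=
  Set.indicator_apply_nonneg fun _ => Real.rpow_nonneg (norm_nonneg z) α

lemma bracket_rpow_neg_mul_farKernel_le {α : ℝ} {n : ℕ} (hn : |α| ≤ n) (v w : 𝔼) :
    √(1 + ‖v‖ ^ 2) ^ (-α) * farKernel α (v - w) ≤ (2 * (1 + ‖w‖)) ^ n := by
  by_cases h : 1 ≤ ‖v - w‖
  · have := norm_sub_div_bracket_rpow_le hn h
    rw [Real.div_rpow (norm_nonneg _) (Real.sqrt_nonneg _), div_eq_mul_inv,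
      ← Real.rpow_neg (Real.sqrt_nonneg _), mul_comm] at this
    simpa [farKernel, h]
  · simp only [farKernel, mem_Ici, h, not_false_eq_true, indicator_of_notMem, mul_zero]
    positivity

lemma tendsto_bracket_rpow_neg_mul_farKernel (α : ℝ) (w : 𝔼) :
    Tendsto (fun v => √(1 + ‖v‖ ^ 2) ^ (-α) * farKernel α (v - w)) (cobounded 𝔼) (𝓝 1) := by
  have h1 := (tendsto_norm_sub_div_bracket w).rpow_const (p := α) (Or.inl one_ne_zero)
  rw [Real.one_rpow] at h1
  refine h1.congr' ?_
  filter_upwards [eventually_cobounded_le_norm (1 + ‖w‖)] with v hv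
  have h : 1 ≤ ‖v - w‖ := by linarith [norm_sub_norm_le v w]
  rw [Real.div_rpow (norm_nonneg _) (Real.sqrt_nonneg _), div_eq_mul_inv,
      ← Real.rpow_neg (Real.sqrt_nonneg _), mul_comm]
  simp [farKernel, h]

lemma integrable_far {h : 𝔼 → ℝ} (hh : RapidDecay h) (α : ℝ) (v : 𝔼) :
    Integrable (fun w => (√(1 + ‖v‖ ^ 2) ^ (-α) * farKernel α (v - w)) * h w) := by
  obtain ⟨n, hn⟩ := exists_nat_ge |α|
  have hm := measurable_farKernel α
  have hc := hh.1.measurable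
  refine (hh.integrable_pow_mul n).mono' (Measurable.aestronglyMeasurable (by fun_prop))
    (Eventually.of_forall fun w => ?_)
  rw [norm_mul, Real.norm_of_nonneg (mul_nonneg (by positivity) (farKernel_nonneg _ _))]
  gcongr
  · exact bracket_rpow_neg_mul_farKernel_le hn v w
  · rfl

lemma tendsto_integral_far {h : 𝔼 → ℝ} (hh : RapidDecay h) (α : ℝ) :
    Tendsto (fun v => ∫ w, (√(1 + ‖v‖ ^ 2) ^ (-α) * farKernel α (v - w)) * h w)
      (cobounded 𝔼) (𝓝 (∫ w, h w)) := by
  obtain ⟨n, hn⟩ := exists_nat_ge |α|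
  have hm := measurable_farKernel α
  have hc := hh.1.measurable
  have : (cobounded 𝔼).IsCountablyGenerated := by
    rw [← comap_norm_atTop]; infer_instance
  refine tendsto_integral_filter_of_dominated_convergence
    (fun w => (2 * (1 + ‖w‖)) ^ n * |h w|)
    (Eventually.of_forall fun v => Measurable.aestronglyMeasurable (by fun_prop))
    (Eventually.of_forall fun v => Eventually.of_forall fun w => ?_) (hh.integrable_pow_mul n)
    (Eventually.of_forall fun w => ?_)
  · rw [norm_mul, Real.norm_of_nonneg (mul_nonneg (by positivity) (farKernel_nonneg _ _))]
    gcongr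
    · exact bracket_rpow_neg_mul_farKernel_le hn v w
    · rfl
  · simpa using (tendsto_bracket_rpow_neg_mul_farKernel α w).mul_const (h w)

lemma integrable_nearKernel_sub {α : ℝ} (hα : -3 < α) (v : 𝔼) :
    Integrable (fun w => nearKernel α (v - w)) :=
  (integrable_indicator_ball_norm_rpow hα).comp_sub_left v

lemma nearKernel_mul_le {h : 𝔼 → ℝ} {n : ℕ} {C : ℝ}
    (hC : ∀ w, (1 + ‖w‖) ^ n * |h w| ≤ C) (α : ℝ) (v w : 𝔼) :
    ‖nearKernel α (v - w) * h w‖ ≤ (2 ^ n * C / √(1 + ‖v‖ ^ 2) ^ n) * nearKernel α (v - w) := by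
  rw [norm_mul, Real.norm_of_nonneg (nearKernel_nonneg _ _), mul_comm]
  by_cases hz : ‖v - w‖ < 1
  · refine mul_le_mul_of_nonneg_right ?_ (nearKernel_nonneg _ _)
    rw [le_div_iff₀ (pow_pos (by linarith [one_le_bracket v]) _)]
    have h5 : ‖v‖ ≤ ‖v - w‖ + ‖w‖ := by
      simpa using norm_add_le (v - w) w
    have h3 : √(1 + ‖v‖ ^ 2) ≤ 2 * (1 + ‖w‖) := by
      linarith [bracket_le_one_add_norm v, norm_nonneg w]
    calc ‖h w‖ * √(1 + ‖v‖ ^ 2) ^ n ≤ ‖h w‖ * (2 * (1 + ‖w‖)) ^ n := by gcongr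
      _ = 2 ^ n * ((1 + ‖w‖) ^ n * |h w|) := by rw [mul_pow, Real.norm_eq_abs]; ring
      _ ≤ 2 ^ n * C := by gcongr; exact hC w
  · simp [nearKernel, hz]

lemma integrable_near {h : 𝔼 → ℝ} (hh : RapidDecay h) {α : ℝ} (hα : -3 < α) (v : 𝔼) :
    Integrable (fun w => nearKernel α (v - w) * h w) := by
  obtain ⟨C, hC⟩ := hh.2 0
  have hm := measurable_nearKernel α
  have hc := hh.1.measurable
  exact ((integrable_nearKernel_sub hα v).const_mul _).mono' (Measurable.aestronglyMeasurable (by fun_prop))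
    (Eventually.of_forall fun w => nearKernel_mul_le hC α v w)

lemma tendsto_integral_near {h : 𝔼 → ℝ} (hh : RapidDecay h) {α : ℝ} (hα : -3 < α) :
    Tendsto (fun v => √(1 + ‖v‖ ^ 2) ^ (-α) * ∫ w, nearKernel α (v - w) * h w)
      (cobounded 𝔼) (𝓝 0) := by
  obtain ⟨n, hn⟩ := exists_nat_gt (-α)
  obtain ⟨C, hC⟩ := hh.2 n
  have hlim : Tendsto (fun v : 𝔼 => √(1 + ‖v‖ ^ 2) ^ (-(n + α)) *
      (2 ^ n * C * ∫ z : 𝔼, nearKernel α z)) (cobounded 𝔼) (𝓝 0) := by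
    simpa using ((tendsto_rpow_neg_atTop (by linarith : 0 < n + α)).comp
      tendsto_bracket_cobounded).mul_const (2 ^ n * C * ∫ z : 𝔼, nearKernel α z)
  refine squeeze_zero_norm (fun v => ?_) hlim
  have hb : 0 < √(1 + ‖v‖ ^ 2) := by positivity
  have h1 : ‖∫ w, nearKernel α (v - w) * h w‖ ≤
      (2 ^ n * C / √(1 + ‖v‖ ^ 2) ^ n) * ∫ z : 𝔼, nearKernel α z := by
    rw [← integral_sub_left_eq_self (nearKernel α) volume v, ← integral_const_mul]
    exact norm_integral_le_of_norm_le ((integrable_nearKernel_sub hα v).const_mul _)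
      (Eventually.of_forall fun w => nearKernel_mul_le hC α v w)
  rw [norm_mul, Real.norm_of_nonneg (by positivity)]
  calc _ ≤ √(1 + ‖v‖ ^ 2) ^ (-α) *
        ((2 ^ n * C / √(1 + ‖v‖ ^ 2) ^ n) * ∫ z : 𝔼, nearKernel α z) := by gcongr
    _ = _ := by
      rw [neg_add, Real.rpow_add hb, Real.rpow_neg hb.le (n : ℝ), Real.rpow_natCast]
      ring

lemma RapidDecay.integrable_norm_sub_rpow_mul {h : 𝔼 → ℝ} (hh : RapidDecay h) {α : ℝ}
    (hα : -3 < α) (v : 𝔼) : Integrable (fun w => ‖v - w‖ ^ α * h w) := by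
  have hb : 0 < √(1 + ‖v‖ ^ 2) := by positivity
  have h2 := (integrable_far hh α v).const_mul (√(1 + ‖v‖ ^ 2) ^ α)
  refine ((integrable_near hh hα v).add h2).congr (Eventually.of_forall fun w => ?_)
  have : √(1 + ‖v‖ ^ 2) ^ α * √(1 + ‖v‖ ^ 2) ^ (-α) = 1 := by
    rw [← Real.rpow_add hb]; simp
  simp only [Pi.add_apply, ← nearKernel_add_farKernel]
  linear_combination farKernel α (v - w) * h w * this

/-- Convolving a rapidly decaying function with `|z|^α` gives `⟨v⟩^α` times its mass, to leading
order at infinity. -/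
lemma RapidDecay.tendsto_bracket_rpow_neg_mul_integral {h : 𝔼 → ℝ} (hh : RapidDecay h) {α : ℝ}
    (hα : -3 < α) :
    Tendsto (fun v => √(1 + ‖v‖ ^ 2) ^ (-α) * ∫ w, ‖v - w‖ ^ α * h w)
      (cobounded 𝔼) (𝓝 (∫ w, h w)) := by
  have h1 := (tendsto_integral_near hh hα).add (tendsto_integral_far hh α)
  rw [zero_add] at h1
  refine h1.congr fun v => ?_
  rw [← integral_const_mul, ← integral_const_mul, ← integral_add
    ((integrable_near hh hα v).const_mul _) (integrable_far hh α v)]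
  congr 1 with w
  rw [← nearKernel_add_farKernel]
  ring

/-- The standard Gaussian density on `ℝ³`. -/
def stdGauss (w : 𝔼) : ℝ := (2 * Real.pi) ^ (-(3 : ℝ) / 2) * Real.exp (-‖w‖ ^ 2 / 2)

lemma integral_stdGauss : ∫ w, stdGauss w = 1 := by
  have h := GaussianFourier.integral_rexp_neg_mul_sq_norm (V := 𝔼) (b := 1 / 2) (by norm_num)
  simp only [stdGauss, integral_const_mul]
  have e : (fun w : 𝔼 => Real.exp (-‖w‖ ^ 2 / 2)) = fun w => Real.exp (-(1 / 2) * ‖w‖ ^ 2) := by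
    ext w; ring_nf
  rw [e, h, finrank_euclideanSpace, Fintype.card_fin, show Real.pi / (1 / 2) = 2 * Real.pi by ring,
    ← Real.rpow_add (by positivity)]
  norm_num

lemma rapidDecay_norm_pow_mul_stdGauss (m : ℕ) : RapidDecay (fun w => ‖w‖ ^ m * stdGauss w) := by
  refine ⟨by unfold stdGauss; fun_prop, fun n =>
    ⟨(2 * Real.pi) ^ (-(3 : ℝ) / 2) * ((n + m).factorial * Real.exp (3 / 2)), fun w => ?_⟩⟩
  have hw := norm_nonneg w
  have h0 : 0 ≤ stdGauss w := by unfold stdGauss; positivity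
  rw [abs_of_nonneg (by positivity)]
  have h1 := Real.pow_div_factorial_le_exp (1 + ‖w‖) (by positivity) (n + m)
  rw [div_le_iff₀ (by positivity)] at h1
  calc (1 + ‖w‖) ^ n * (‖w‖ ^ m * stdGauss w)
      ≤ (1 + ‖w‖) ^ n * ((1 + ‖w‖) ^ m * stdGauss w) := by gcongr; linarith
    _ = (2 * Real.pi) ^ (-(3 : ℝ) / 2) * ((1 + ‖w‖) ^ (n + m) * Real.exp (-‖w‖ ^ 2 / 2)) := by
        rw [stdGauss, pow_add]; ring
    _ ≤ (2 * Real.pi) ^ (-(3 : ℝ) / 2) *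
        ((Real.exp (1 + ‖w‖) * (n + m).factorial) * Real.exp (-‖w‖ ^ 2 / 2)) := by gcongr
    _ = (2 * Real.pi) ^ (-(3 : ℝ) / 2) *
        ((n + m).factorial * Real.exp (1 + ‖w‖ + -‖w‖ ^ 2 / 2)) := by
        rw [Real.exp_add (1 + ‖w‖)]; ring
    _ ≤ _ := by gcongr; nlinarith [sq_nonneg (‖w‖ - 1)]

/-- The weighted moment `∫ |v - w|^α |w|^m μ(w) dw` of the Gaussian. -/
def gaussMoment (m : ℕ) (α : ℝ) (v : 𝔼) : ℝ := ∫ w, ‖v - w‖ ^ α * (‖w‖ ^ m * stdGauss w)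

lemma stdGauss_nonneg (w : 𝔼) : 0 ≤ stdGauss w := by unfold stdGauss; positivity

lemma measurable_stdGauss : Measurable stdGauss := by unfold stdGauss; fun_prop

lemma integrable_gaussMoment (m : ℕ) {α : ℝ} (hα : -3 < α) (v : 𝔼) :
    Integrable (fun w => ‖v - w‖ ^ α * (‖w‖ ^ m * stdGauss w)) :=
  (rapidDecay_norm_pow_mul_stdGauss m).integrable_norm_sub_rpow_mul hα v

lemma tendsto_gaussMoment (m : ℕ) {α : ℝ} (hα : -3 < α) :
    Tendsto (fun v => √(1 + ‖v‖ ^ 2) ^ (-α) * gaussMoment m α v) (cobounded 𝔼)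
      (𝓝 (∫ w, ‖w‖ ^ m * stdGauss w)) :=
  (rapidDecay_norm_pow_mul_stdGauss m).tendsto_bracket_rpow_neg_mul_integral hα

lemma ae_ne_sub (v : 𝔼) : ∀ᵐ w : 𝔼, v - w ≠ 0 := by
  have : ∀ᵐ w : 𝔼, w ≠ v := compl_mem_ae_iff.2 (measure_singleton v)
  filter_upwards [this] with w hw h
  exact hw (sub_eq_zero.1 h).symm

lemma norm_sq_eq_coords (z : 𝔼) : ‖z‖ ^ 2 = z 0 ^ 2 + z 1 ^ 2 + z 2 ^ 2 := by
  simp [EuclideanSpace.norm_sq_eq, Fin.sum_univ_three]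

lemma abs_coord_le_norm (z : 𝔼) (i : Fin 3) : |z i| ≤ ‖z‖ := PiLp.norm_apply_le z i

/-- The Landau kernel `a_{ij}(z) = |z|^{γ+2} (δ_{ij} - z_i z_j / |z|²)`. -/
def landauKernel (γ : ℝ) (z : 𝔼) (i j : Fin 3) : ℝ :=
  ‖z‖ ^ (γ + 2) * ((if i = j then (1 : ℝ) else 0) - z i * z j / ‖z‖ ^ 2)

lemma abs_landauKernel_le (γ : ℝ) (z : 𝔼) (i j : Fin 3) :
    |landauKernel γ z i j| ≤ 2 * ‖z‖ ^ (γ + 2) := by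
  have h0 : 0 ≤ ‖z‖ ^ (γ + 2) := by positivity
  have h1 : |z i * z j / ‖z‖ ^ 2| ≤ 1 := by
    rw [abs_div, abs_mul, abs_of_nonneg (sq_nonneg ‖z‖), sq]
    exact div_le_one_of_le₀ (mul_le_mul (abs_coord_le_norm z i) (abs_coord_le_norm z j)
      (abs_nonneg _) (norm_nonneg _)) (by positivity)
  have h2 : |(if i = j then (1 : ℝ) else 0)| ≤ 1 := by split_ifs <;> simp
  rw [landauKernel, abs_mul, abs_of_nonneg h0, mul_comm]
  gcongr
  linarith [abs_sub (if i = j then (1 : ℝ) else 0) (z i * z j / ‖z‖ ^ 2)]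

lemma integrable_landauKernel {γ : ℝ} (hγ : -3 ≤ γ) (v : 𝔼) (i j : Fin 3) :
    Integrable (fun w => landauKernel γ (v - w) i j * stdGauss w) := by
  have hm := measurable_stdGauss
  refine ((integrable_gaussMoment 0 (by linarith : -3 < γ + 2) v).const_mul 2).mono'
    (Measurable.aestronglyMeasurable (by unfold landauKernel; fun_prop))
    (Eventually.of_forall fun w => ?_)
  rw [norm_mul, Real.norm_of_nonneg (stdGauss_nonneg w), pow_zero, one_mul, ← mul_assoc]
  exact mul_le_mul_of_nonneg_right (abs_landauKernel_le γ _ i j) (stdGauss_nonneg w)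

lemma sum_landauKernel_diag (γ : ℝ) {z : 𝔼} (hz : z ≠ 0) :
    ∑ i, landauKernel γ z i i = 2 * ‖z‖ ^ (γ + 2) := by
  have hn : ‖z‖ ^ 2 ≠ 0 := by simpa using hz
  have h := norm_sq_eq_coords z
  have hi := mul_inv_cancel₀ hn
  simp only [landauKernel, Fin.sum_univ_three, if_true, div_eq_mul_inv]
  linear_combination ‖z‖ ^ (γ + 2) * (‖z‖ ^ 2)⁻¹ * h - ‖z‖ ^ (γ + 2) * hi

lemma abs_landauKernel_quadratic_le (γ : ℝ) {z : 𝔼} (hz : z ≠ 0) (w : 𝔼) :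
    |∑ i, ∑ j, landauKernel γ z i j * ((z + w) i * (z + w) j)| ≤ ‖z‖ ^ (γ + 2) * ‖w‖ ^ 2 := by
  have hn : 0 < ‖z‖ ^ 2 := by positivity
  have h0 : 0 ≤ ‖z‖ ^ (γ + 2) := by positivity
  have h := norm_sq_eq_coords z
  have hw := norm_sq_eq_coords w
  set d := z 0 * w 0 + z 1 * w 1 + z 2 * w 2 with hd
  have e : ∑ i, ∑ j, landauKernel γ z i j * ((z + w) i * (z + w) j) =
      ‖z‖ ^ (γ + 2) * (‖w‖ ^ 2 - d ^ 2 / ‖z‖ ^ 2) := by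
    have hi := mul_inv_cancel₀ hn.ne'
    generalize hq : (‖z‖ ^ 2)⁻¹ = q at hi
    rw [h] at hi
    simp only [landauKernel, Fin.sum_univ_three, PiLp.add_apply, Fin.isValue, if_true,
      Fin.reduceEq, if_false, div_eq_mul_inv, hq]
    rw [hw, hd]
    linear_combination (-‖z‖ ^ (γ + 2) * (z 0 ^ 2 + z 1 ^ 2 + z 2 ^ 2
      + 2 * (z 0 * w 0 + z 1 * w 1 + z 2 * w 2))) * hi
  have hcs : d ^ 2 ≤ ‖z‖ ^ 2 * ‖w‖ ^ 2 := by
    rw [h, hw, hd]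
    nlinarith [sq_nonneg (z 0 * w 1 - z 1 * w 0), sq_nonneg (z 0 * w 2 - z 2 * w 0),
      sq_nonneg (z 1 * w 2 - z 2 * w 1)]
  have h1 : d ^ 2 / ‖z‖ ^ 2 ≤ ‖w‖ ^ 2 := by
    rw [div_le_iff₀ hn]; linarith
  have h2 : 0 ≤ d ^ 2 / ‖z‖ ^ 2 := by positivity
  rw [e, abs_mul, abs_of_nonneg h0, abs_of_nonneg (by linarith)]
  gcongr
  linarith

lemma sum_integral_landauKernel_diag {γ : ℝ} (hγ : -3 ≤ γ) (v : 𝔼) :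
    ∑ i, ∫ w, landauKernel γ (v - w) i i * stdGauss w = 2 * gaussMoment 0 (γ + 2) v := by
  rw [← integral_finsetSum _ fun i _ => integrable_landauKernel hγ v i i, gaussMoment,
    ← integral_const_mul]
  refine integral_congr_ae ?_
  filter_upwards [ae_ne_sub v] with w hw
  rw [← Finset.sum_mul, sum_landauKernel_diag γ hw]
  ring

lemma abs_integral_landauKernel_quadratic_le {γ : ℝ} (hγ : -3 ≤ γ) (v : 𝔼) :
    |∑ i, ∑ j, (∫ w, landauKernel γ (v - w) i j * stdGauss w) * (v i * v j)| ≤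
      gaussMoment 2 (γ + 2) v := by
  have e : ∑ i, ∑ j, (∫ w, landauKernel γ (v - w) i j * stdGauss w) * (v i * v j) =
      ∫ w, ∑ i, ∑ j, landauKernel γ (v - w) i j * stdGauss w * (v i * v j) := by
    rw [integral_finsetSum _ fun i _ => integrable_finsetSum _ fun j _ =>
      (integrable_landauKernel hγ v i j).mul_const _]
    refine Finset.sum_congr rfl fun i _ => ?_
    rw [integral_finsetSum _ fun j _ => (integrable_landauKernel hγ v i j).mul_const _]
    exact Finset.sum_congr rfl fun j _ => (integral_mul_const _ _).symm
  rw [e, ← Real.norm_eq_abs]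
  refine norm_integral_le_of_norm_le (integrable_gaussMoment 2 (by linarith : -3 < γ + 2) v) ?_
  filter_upwards [ae_ne_sub v] with w hw
  have h := abs_landauKernel_quadratic_le γ hw w
  rw [sub_add_cancel] at h
  have e2 : ∑ i, ∑ j, landauKernel γ (v - w) i j * stdGauss w * (v i * v j) =
      (∑ i, ∑ j, landauKernel γ (v - w) i j * (v i * v j)) * stdGauss w := by
    simp only [Finset.sum_mul]
    exact Finset.sum_congr rfl fun i _ => Finset.sum_congr rfl fun j _ => by ring
  rw [e2, norm_mul, Real.norm_of_nonneg (stdGauss_nonneg w), ← mul_assoc]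
  exact mul_le_mul_of_nonneg_right h (stdGauss_nonneg w)

lemma norm_rpow_mul_norm {z : 𝔼} (hz : z ≠ 0) (γ : ℝ) : ‖z‖ ^ γ * ‖z‖ = ‖z‖ ^ (γ + 1) := by
  rw [Real.rpow_add (norm_pos_iff.2 hz), Real.rpow_one]

lemma integrable_driftKernel {γ : ℝ} (hγ : -3 ≤ γ) (v : 𝔼) (i : Fin 3) :
    Integrable (fun w => (-2 * ‖v - w‖ ^ γ * (v - w) i) * stdGauss w) := by
  have hm := measurable_stdGauss
  refine ((integrable_gaussMoment 0 (by linarith : -3 < γ + 1) v).const_mul 2).mono'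
    (Measurable.aestronglyMeasurable (by fun_prop)) ?_
  filter_upwards [ae_ne_sub v] with w hw
  rw [norm_mul, Real.norm_of_nonneg (stdGauss_nonneg w), pow_zero, one_mul, ← mul_assoc]
  refine mul_le_mul_of_nonneg_right ?_ (stdGauss_nonneg w)
  have h0 : 0 ≤ ‖v - w‖ ^ γ := by positivity
  rw [← norm_rpow_mul_norm hw, norm_mul, norm_mul, Real.norm_of_nonneg h0, mul_assoc]
  norm_num
  gcongr
  exact abs_coord_le_norm (v - w) i

lemma abs_integral_driftKernel_add_le {γ : ℝ} (hγ : -3 ≤ γ) (v : 𝔼) :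
    |∑ i, (∫ w, (-2 * ‖v - w‖ ^ γ * (v - w) i) * stdGauss w) * v i
      + 2 * gaussMoment 0 (γ + 2) v| ≤ 2 * gaussMoment 1 (γ + 1) v := by
  have e : ∑ i, (∫ w, (-2 * ‖v - w‖ ^ γ * (v - w) i) * stdGauss w) * v i =
      ∫ w, ∑ i, (-2 * ‖v - w‖ ^ γ * (v - w) i) * stdGauss w * v i := by
    rw [integral_finsetSum _ fun i _ => (integrable_driftKernel hγ v i).mul_const _]
    exact Finset.sum_congr rfl fun i _ => (integral_mul_const _ _).symm
  rw [e, gaussMoment, gaussMoment, ← integral_const_mul, ← integral_const_mul, ← integral_add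
    (integrable_finsetSum _ fun i _ => (integrable_driftKernel hγ v i).mul_const _)
    ((integrable_gaussMoment 0 (by linarith) v).const_mul 2), ← Real.norm_eq_abs]
  refine norm_integral_le_of_norm_le
    ((integrable_gaussMoment 1 (by linarith : -3 < γ + 1) v).const_mul 2) ?_
  filter_upwards [ae_ne_sub v] with w hw
  have h0 : 0 ≤ ‖v - w‖ ^ γ := by positivity
  have hsq : ‖v - w‖ ^ (γ + 2) = ‖v - w‖ ^ γ * ‖v - w‖ ^ 2 := by
    rw [Real.rpow_add (norm_pos_iff.2 hw)]; norm_num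
  have hinner : ∑ i, (v - w) i * w i = inner ℝ w (v - w) := by
    simp [PiLp.inner_apply]
  have e2 : ∑ i, (-2 * ‖v - w‖ ^ γ * (v - w) i) * stdGauss w * v i +
      2 * (‖v - w‖ ^ (γ + 2) * (‖w‖ ^ 0 * stdGauss w)) =
      -2 * (‖v - w‖ ^ γ * (inner ℝ w (v - w) * stdGauss w)) := by
    rw [hsq, norm_sq_eq_coords (v - w), ← hinner]
    simp only [Fin.sum_univ_three, PiLp.sub_apply]
    ring
  rw [e2, ← norm_rpow_mul_norm hw, norm_mul, norm_mul, norm_mul, Real.norm_of_nonneg h0,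
    Real.norm_of_nonneg (stdGauss_nonneg w)]
  have hc := norm_inner_le_norm (𝕜 := ℝ) w (v - w)
  have hg := stdGauss_nonneg w
  calc _ ≤ ‖(-2 : ℝ)‖ * (‖v - w‖ ^ γ * (‖w‖ * ‖v - w‖ * stdGauss w)) := by gcongr
    _ = _ := by norm_num; ring

lemma tendsto_bracket_rpow_neg {a : ℝ} (ha : 0 < a) :
    Tendsto (fun v : 𝔼 => √(1 + ‖v‖ ^ 2) ^ (-a)) (cobounded 𝔼) (𝓝 0) :=
  (tendsto_rpow_neg_atTop ha).comp tendsto_bracket_cobounded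

lemma tendsto_bracket_rpow_mul_stdGauss (a : ℝ) :
    Tendsto (fun v => √(1 + ‖v‖ ^ 2) ^ a * stdGauss v) (cobounded 𝔼) (𝓝 0) := by
  obtain ⟨n, hn⟩ := exists_nat_gt a
  obtain ⟨C, hC⟩ := (rapidDecay_norm_pow_mul_stdGauss 0).2 n
  have hlim := (tendsto_bracket_rpow_neg (sub_pos.2 hn)).mul_const C
  rw [zero_mul] at hlim
  refine squeeze_zero (fun v => mul_nonneg (by positivity) (stdGauss_nonneg v)) (fun v => ?_) hlim
  have hb : 0 < √(1 + ‖v‖ ^ 2) := by positivity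
  have hg := stdGauss_nonneg v
  have h := hC v
  simp only [pow_zero, one_mul, abs_of_nonneg hg] at h
  have h2 : √(1 + ‖v‖ ^ 2) ^ n * stdGauss v ≤ C :=
    (mul_le_mul_of_nonneg_right (pow_le_pow_left₀ hb.le (bracket_le_one_add_norm v) n) hg).trans h
  calc √(1 + ‖v‖ ^ 2) ^ a * stdGauss v
      = √(1 + ‖v‖ ^ 2) ^ (-(n - a)) * (√(1 + ‖v‖ ^ 2) ^ n * stdGauss v) := by
        rw [← mul_assoc, ← Real.rpow_natCast _ n, ← Real.rpow_add hb]; ring_nf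
    _ ≤ _ := by gcongr

lemma tendsto_bracket_rpow_neg_mul_of_abs_le {f g : 𝔼 → ℝ} {α a L : ℝ} (ha : 0 < a)
    (hfg : ∀ v, |f v| ≤ g v)
    (hg : Tendsto (fun v => √(1 + ‖v‖ ^ 2) ^ (-α) * g v) (cobounded 𝔼) (𝓝 L)) :
    Tendsto (fun v => √(1 + ‖v‖ ^ 2) ^ (-(a + α)) * f v) (cobounded 𝔼) (𝓝 0) := by
  have hlim := (tendsto_bracket_rpow_neg ha).mul hg
  rw [zero_mul] at hlim
  refine squeeze_zero_norm (fun v => ?_) hlim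
  rw [neg_add, Real.rpow_add (by positivity), mul_assoc, norm_mul, norm_mul,
    Real.norm_of_nonneg (by positivity), Real.norm_of_nonneg (by positivity)]
  gcongr
  exact hfg v

/-- The weight exponent function of `B₀`, with the derivatives of the stretched exponential
weight computed. -/
lemma weightExponent_eq (κ s θ c : ℝ) (a : Fin 3 → Fin 3 → ℝ) (b : Fin 3 → ℝ) (v : 𝔼)
    {ω : 𝔼 → ℝ} (hω : ω = fun v => Real.exp (κ * (1 + ‖v‖ ^ 2) ^ (s / 2))) :
    2 * (1 - θ) * (∑ i, ∑ j, a i j * (pd ω i v / ω v) * (pd ω j v / ω v))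
      + (2 * θ - 1) * (∑ i, ∑ j, a i j * pd (pd ω j) i v / ω v)
      + 2 * θ * (∑ i, b i * pd ω i v / ω v) + (θ - 1) * c =
    ((κ * s) ^ 2 * ((1 + ‖v‖ ^ 2) ^ (s / 2 - 1)) ^ 2
        + (2 * θ - 1) * (κ * s * (s - 2)) * (1 + ‖v‖ ^ 2) ^ (s / 2 - 2))
        * (∑ i, ∑ j, a i j * (v i * v j))
      + κ * s * (1 + ‖v‖ ^ 2) ^ (s / 2 - 1) *
        ((2 * θ - 1) * ∑ i, a i i + 2 * θ * ∑ i, b i * v i)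
      + (θ - 1) * c := by
  have hne : Real.exp (κ * (1 + ‖v‖ ^ 2) ^ (s / 2)) ≠ 0 := (Real.exp_pos _).ne'
  subst hω
  simp only [mul_div_assoc, pd_stretchedExp, pd_pd_stretchedExp, mul_div_cancel_left₀ _ hne,
    Fin.sum_univ_three, Fin.isValue, if_true, Fin.reduceEq, if_false]
  ring

/-- For the operator `B₀f = ā_{ij}∂²_{ij}f - c̄f` and the stretched
exponential weight `ω = exp(κ⟨v⟩^s)`, `s ∈ (0,2)`, `k = κs`, the weight exponent
function `ϖ^{B₀}_{ω,p}` satisfies `limsup_{|v|→∞} ⟨v⟩^{-γ-s} ϖ^{B₀}_{ω,p}(v) ≤ -2k < 0`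
for every `p ∈ [1,∞]` (with the convention `1/∞ = 0`). -/
theorem varpi_B0_limsup_neg
    (γ : ℝ) (hγ : γ ∈ Set.Icc (-3 : ℝ) 1)
    (p : ℝ≥0∞) (hp : 1 ≤ p)
    (s κ k : ℝ) (hs : s ∈ Set.Ioo (0 : ℝ) 2) (hκ : 0 < κ) (hk : k = κ * s)
    (μ : EuclideanSpace ℝ (Fin 3) → ℝ)
    (hμ : ∀ v, μ v = (2 * Real.pi) ^ (-(3 : ℝ) / 2) * Real.exp (-‖v‖ ^ 2 / 2))
    (abar : EuclideanSpace ℝ (Fin 3) → Fin 3 → Fin 3 → ℝ)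
    (habar : ∀ v i j, abar v i j = ∫ w : EuclideanSpace ℝ (Fin 3),
      (‖v - w‖ ^ (γ + 2) *
        ((if i = j then (1 : ℝ) else 0) - (v - w) i * (v - w) j / ‖v - w‖ ^ 2)) * μ w)
    (bbar : EuclideanSpace ℝ (Fin 3) → Fin 3 → ℝ)
    (hbbar : ∀ v i, bbar v i = ∫ w : EuclideanSpace ℝ (Fin 3),
      (-2 * ‖v - w‖ ^ γ * (v - w) i) * μ w)
    (cbar : EuclideanSpace ℝ (Fin 3) → ℝ)
    (hcbar3 : γ = -3 → ∀ v, cbar v = -8 * Real.pi * μ v)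
    (hcbar : -3 < γ → ∀ v, cbar v = ∫ w : EuclideanSpace ℝ (Fin 3),
      (-2 * (γ + 3) * ‖v - w‖ ^ γ) * μ w)
    (ω : EuclideanSpace ℝ (Fin 3) → ℝ)
    (hω : ∀ v, ω v = Real.exp (κ * (1 + ‖v‖ ^ 2) ^ (s / 2)))
    (ϖ : EuclideanSpace ℝ (Fin 3) → ℝ)
    (hϖ : ∀ v, ϖ v =
      2 * (1 - (1 / p).toReal) *
        (∑ i, ∑ j, abar v i j * (pd ω i v / ω v) * (pd ω j v / ω v))
      + (2 * (1 / p).toReal - 1) * (∑ i, ∑ j, abar v i j * pd (pd ω j) i v / ω v)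
      + 2 * (1 / p).toReal * (∑ i, bbar v i * pd ω i v / ω v)
      + ((1 / p).toReal - 1) * cbar v) :
    Filter.limsup (fun v : EuclideanSpace ℝ (Fin 3) =>
        (1 + ‖v‖ ^ 2) ^ (-(γ + s) / 2) * ϖ v)
      (Filter.comap (fun v : EuclideanSpace ℝ (Fin 3) => ‖v‖) Filter.atTop)
      ≤ -2 * k
    ∧ -2 * k < 0 := by
  obtain ⟨hs0, hs2⟩ := hs
  have hγ3 := hγ.1
  obtain rfl : μ = stdGauss := funext hμ
  refine ⟨?_, by subst hk; have := mul_pos hκ hs0; linarith⟩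
  generalize (1 / p).toReal = θ at hϖ
  have ha : ∀ v i j, abar v i j = ∫ w, landauKernel γ (v - w) i j * stdGauss w := habar
  set Q : 𝔼 → ℝ := fun v => ∑ i, ∑ j, abar v i j * (v i * v j)
  set J : 𝔼 → ℝ := gaussMoment 0 (γ + 2)
  set e : 𝔼 → ℝ := fun v => ∑ i, bbar v i * v i + 2 * J v with he
  have hT : ∀ v, ∑ i, abar v i i = 2 * J v := fun v => by
    simp only [ha]; exact sum_integral_landauKernel_diag hγ3 v
  have hQ : ∀ v, |Q v| ≤ gaussMoment 2 (γ + 2) v := fun v => by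
    simp only [Q, ha]; exact abs_integral_landauKernel_quadratic_le hγ3 v
  have he_le : ∀ v, |e v| ≤ 2 * gaussMoment 1 (γ + 1) v := fun v => by
    simp only [e, hbbar]; exact abs_integral_driftKernel_add_le hγ3 v
  have hQlim := tendsto_gaussMoment 2 (by linarith : -3 < γ + 2)
  have l1 := tendsto_bracket_rpow_neg_mul_of_abs_le (by linarith : 0 < 2 - s) hQ hQlim
  have l2 := tendsto_bracket_rpow_neg_mul_of_abs_le (by norm_num : (0 : ℝ) < 2) hQ hQlim
  have l3 := tendsto_gaussMoment 0 (by linarith : -3 < γ + 2)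
  simp only [pow_zero, one_mul, integral_stdGauss] at l3
  have l4 : Tendsto (fun v => √(1 + ‖v‖ ^ 2) ^ (-(1 + (γ + 1))) * e v) (cobounded 𝔼) (𝓝 0) :=
    tendsto_bracket_rpow_neg_mul_of_abs_le one_pos he_le
      (((tendsto_gaussMoment 1 (by linarith : -3 < γ + 1)).const_mul 2).congr fun v => by ring)
  have l5 : Tendsto (fun v => √(1 + ‖v‖ ^ 2) ^ (-(s + γ)) * cbar v) (cobounded 𝔼) (𝓝 0) := by
    rcases hγ3.eq_or_lt with h | h
    · have := (tendsto_bracket_rpow_mul_stdGauss (-(s + γ))).const_mul (-8 * Real.pi)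
      rw [mul_zero] at this
      exact this.congr fun v => by rw [hcbar3 h.symm]; ring
    · have := ((tendsto_bracket_rpow_neg hs0).mul (tendsto_gaussMoment 0 h)).const_mul
        (-2 * (γ + 3))
      rw [zero_mul, mul_zero] at this
      refine this.congr fun v => ?_
      have hc : cbar v = -2 * (γ + 3) * gaussMoment 0 γ v := by
        rw [hcbar h, gaussMoment, ← integral_const_mul]
        congr 1 with w
        ring
      rw [hc, neg_add, Real.rpow_add (by positivity)]
      ring
  have hlim := ((((l1.const_mul (k ^ 2)).add (l2.const_mul ((2 * θ - 1) * (k * (s - 2))))).add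
    (l3.const_mul (-2 * k))).add (l4.const_mul (2 * θ * k))).add (l5.const_mul (θ - 1))
  simp only [mul_zero, add_zero, zero_add, mul_one] at hlim
  have : Filter.comap (fun v : 𝔼 => ‖v‖) atTop = cobounded 𝔼 := comap_norm_atTop
  rw [this]
  refine (Tendsto.limsup_eq (hlim.congr fun v => ?_)).le
  have hb : 0 < √(1 + ‖v‖ ^ 2) := by positivity
  have hX : (0 : ℝ) ≤ 1 + ‖v‖ ^ 2 := by positivity
  have hD : ∑ i, bbar v i * v i = e v - 2 * J v := by simp [he]
  rw [hϖ, weightExponent_eq κ s θ _ _ _ v (funext hω), hT, hD, ← hk,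
    show s / 2 - 1 = (s - 2) / 2 by ring, show s / 2 - 2 = (s - 4) / 2 by ring,
    Real.rpow_div_two_eq_sqrt _ hX, Real.rpow_div_two_eq_sqrt _ hX,
    Real.rpow_div_two_eq_sqrt _ hX]
  have e1 : √(1 + ‖v‖ ^ 2) ^ (-(2 - s + (γ + 2))) =
      √(1 + ‖v‖ ^ 2) ^ (-(γ + s)) * (√(1 + ‖v‖ ^ 2) ^ (s - 2)) ^ 2 := by
    rw [sq (_ ^ (s - 2)), ← Real.rpow_add hb, ← Real.rpow_add hb]; ring_nf
  have e2 : √(1 + ‖v‖ ^ 2) ^ (-(2 + (γ + 2))) =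
      √(1 + ‖v‖ ^ 2) ^ (-(γ + s)) * √(1 + ‖v‖ ^ 2) ^ (s - 4) := by
    rw [← Real.rpow_add hb]; ring_nf
  have e3 : √(1 + ‖v‖ ^ 2) ^ (-(γ + 2)) =
      √(1 + ‖v‖ ^ 2) ^ (-(γ + s)) * √(1 + ‖v‖ ^ 2) ^ (s - 2) := by
    rw [← Real.rpow_add hb]; ring_nf
  rw [e1, e2, show 1 + (γ + 1) = γ + 2 by ring, e3, add_comm s γ]
  ring
end
end
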